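/- Suppose ℛ = {0, 1} (binary RSV) and: (Randomization) under P(·|S = e), D is independent of the pair (Y(0), Y(1)); (Positivity) P(S = e, D = d, Y = y) > 0, P(S = o, Y = y) > 0, P(R = r, S = o) > 0 and P(Y = y) > 0 for all d, y, r ∈ {0, 1}; (Stability) R is conditionally independent of S given (D, Y); (No direct effect) R is conditionally independent of D given Y. Define g(r) := E[Y | R = r, S = o], θ̃ := E[g(R) | D = 1, S = e] − E[g(R) | D = 0, S = e], β̃ := g(1) − g(0), β := E[R | Y = 1] − E[R | Y = 0], and θ := E[Y(1) − Y(0) | S = e]. Then θ̃ = β̃ · β · θ. -/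

import Mathlib

open MeasureTheory ProbabilityTheory

noncomputable section

/-- Sample indicator values: experimental (`e`) or observational (`o`). -/
inductive Sample : Type
  | e
  | o
deriving DecidableEq

instance : MeasurableSpace Sample := ⊤

/-- Real-valued indicator of a boolean (`{0,1}`-valued variable). -/
def b2r (b : Bool) : ℝ := if b then 1 else 0

/-- `CondIndepOf P R V W` : the conditional law of `R` given `V = v, W = w` agrees with
the conditional law of `R` given `V = v`, for all values with positive probability;
this is the notion of "R is conditionally independent of W given V" for variables with
countable ranges. -/
def CondIndepOf {Ω 𝓡 V W : Type*} [MeasurableSpace Ω] [MeasurableSpace 𝓡]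
    (P : Measure Ω) (R : Ω → 𝓡) (Vf : Ω → V) (Wf : Ω → W) : Prop :=
  ∀ v w, 0 < P {ω | Vf ω = v ∧ Wf ω = w} →
    (P[|{ω | Vf ω = v ∧ Wf ω = w}]).map R = (P[|{ω | Vf ω = v}]).map R

theorem cond_real_eq_inv_mul {Ω : Type*} [MeasurableSpace Ω] (μ : Measure Ω) {s : Set Ω}
    (hs : MeasurableSet s) (t : Set Ω) :
    (μ[|s]).real t = (μ.real s)⁻¹ * μ.real (s ∩ t) := by
  simp [measureReal_def, cond_apply hs, ENNReal.toReal_mul, ENNReal.toReal_inv]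

theorem integral_comp_bool {Ω : Type*} [MeasurableSpace Ω] (μ : Measure Ω)
    [IsProbabilityMeasure μ] {f : Ω → Bool} (hf : Measurable f) (h : Bool → ℝ) :
    ∫ ω, h (f ω) ∂μ = h false + (h true - h false) * μ.real {ω | f ω = true} := by
  have hm : MeasurableSet {ω | f ω = true} := hf (measurableSet_singleton true)
  have heq : (fun ω => h (f ω)) =
      fun ω => h false + {ω | f ω = true}.indicator (fun _ => h true - h false) ω := by
    funext ω
    cases hω : f ω <;> simp [Set.indicator, hω]
  rw [heq, integral_add (integrable_const _) ((integrable_const _).indicator hm),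
    integral_indicator_const _ hm]
  simp [mul_comm]

theorem integral_b2r {Ω : Type*} [MeasurableSpace Ω] (μ : Measure Ω)
    [IsProbabilityMeasure μ] {f : Ω → Bool} (hf : Measurable f) :
    ∫ ω, b2r (f ω) ∂μ = μ.real {ω | f ω = true} := by
  rw [integral_comp_bool μ hf b2r]
  simp [b2r]

theorem integrable_b2r {Ω : Type*} [MeasurableSpace Ω] (μ : Measure Ω)
    [IsProbabilityMeasure μ] {f : Ω → Bool} (hf : Measurable f) :
    Integrable (fun ω => b2r (f ω)) μ :=
  Integrable.of_bound ((measurable_of_countable b2r).comp hf).aestronglyMeasurable 1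
    (.of_forall fun ω => by cases f ω <;> simp [b2r])

/-- If, on each stratum `Y = y`, the conditional probability of `B` given `A` is `q y`, then the
conditional probability of `B` given `A` is the mixture of the `q y`. -/
theorem cond_real_eq_mixture {Ω : Type*} [MeasurableSpace Ω] (P : Measure Ω)
    [IsProbabilityMeasure P] {Y : Ω → Bool} (hY : Measurable Y) {A B : Set Ω}
    (hA : MeasurableSet A) (hPA : P A ≠ 0) {q : Bool → ℝ}
    (hpos : ∀ y, P (A ∩ {ω | Y ω = y}) ≠ 0)
    (hq : ∀ y, (P[|A ∩ {ω | Y ω = y}]).real B = q y) :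
    (P[|A]).real B = q false + (q true - q false) * (P[|A]).real {ω | Y ω = true} := by
  have hYm : ∀ y, MeasurableSet {ω | Y ω = y} := fun y => hY (measurableSet_singleton y)
  have hcompl : {ω | Y ω = true}ᶜ = {ω | Y ω = false} := by ext ω; simp
  have hA0 : P.real A ≠ 0 := by simpa [measureReal_eq_zero_iff] using hPA
  have hmul : ∀ y, P.real (A ∩ {ω | Y ω = y} ∩ B) = q y * P.real (A ∩ {ω | Y ω = y}) := by
    intro y
    have h0 : P.real (A ∩ {ω | Y ω = y}) ≠ 0 := by
      simpa [measureReal_eq_zero_iff] using hpos y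
    rw [← hq y, cond_real_eq_inv_mul _ (hA.inter (hYm y))]
    field_simp
  have hsplitB := measureReal_inter_add_sdiff (μ := P) (s := A ∩ B) (hYm true)
  have hsplit := measureReal_inter_add_sdiff (μ := P) (s := A) (hYm true)
  rw [Set.sdiff_eq, hcompl] at hsplitB hsplit
  rw [Set.inter_right_comm, Set.inter_right_comm A B, hmul, hmul] at hsplitB
  rw [cond_real_eq_inv_mul _ hA, cond_real_eq_inv_mul _ hA, ← hsplitB]
  field_simp
  rw [← hsplit]
  ring

theorem cond_cond_real_of_indepFun {Ω α β : Type*} [MeasurableSpace Ω] [MeasurableSpace α]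
    [MeasurableSpace β] (μ : Measure Ω) [IsProbabilityMeasure μ] {D : Ω → α} {Z : Ω → β}
    (h : IndepFun D Z μ) (hD : Measurable D) {s : Set α} {t : Set β} (hs : MeasurableSet s)
    (ht : MeasurableSet t) (h0 : μ (D ⁻¹' s) ≠ 0) :
    (μ[|D ⁻¹' s]).real (Z ⁻¹' t) = μ.real (Z ⁻¹' t) := by
  have h0' : μ.real (D ⁻¹' s) ≠ 0 := by simpa [measureReal_eq_zero_iff] using h0
  rw [cond_real_eq_inv_mul _ (hD hs), measureReal_def μ (_ ∩ _),
    h.measure_inter_preimage_eq_mul _ _ hs ht,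
    ENNReal.toReal_mul, ← measureReal_def, ← measureReal_def]
  field_simp

/-- **Proposition (Bias of common practice with binary RSV): `θ̃ = β̃ · β · θ`.** -/
theorem statement6
    {Ω : Type*} [MeasurableSpace Ω]
    (P : Measure Ω) [IsProbabilityMeasure P]
    (S : Ω → Sample) (D : Ω → Bool) (Y0 Y1 : Ω → Bool) (R : Ω → Bool)
    (hS : Measurable S) (hD : Measurable D) (hY0 : Measurable Y0) (hY1 : Measurable Y1)
    (hR : Measurable R)
    (Y : Ω → Bool) (hYdef : ∀ ω, Y ω = if D ω then Y1 ω else Y0 ω)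
    -- Randomization: D ⫫ (Y(0), Y(1)) under P(·|S = e)
    (randomization :
      IndepFun D (fun ω => (Y0 ω, Y1 ω)) (P[|{ω | S ω = Sample.e}]))
    -- Positivity
    (positivity_e : ∀ d y : Bool,
      0 < P {ω | S ω = Sample.e ∧ D ω = d ∧ Y ω = y})
    (positivity_o : ∀ y : Bool, 0 < P {ω | S ω = Sample.o ∧ Y ω = y})
    (positivity_Ro : ∀ r : Bool, 0 < P {ω | R ω = r ∧ S ω = Sample.o})
    (positivity_Y : ∀ y : Bool, 0 < P {ω | Y ω = y})
    -- Stability: R ⫫ S | (D, Y)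
    (stability : CondIndepOf P R (fun ω => (D ω, Y ω)) S)
    -- No direct effect: R ⫫ D | Y
    (noDirectEffect : CondIndepOf P R Y D)
    -- g(r) := E[Y | R = r, S = o]
    (g : Bool → ℝ)
    (hg : ∀ r, g r = ∫ ω, b2r (Y ω) ∂(P[|{ω | R ω = r ∧ S ω = Sample.o}]))
    -- θ̃ := E[g(R) | D = 1, S = e] − E[g(R) | D = 0, S = e]
    (θt : ℝ)
    (hθt : θt = (∫ ω, g (R ω) ∂(P[|{ω | D ω = true ∧ S ω = Sample.e}])) -
      (∫ ω, g (R ω) ∂(P[|{ω | D ω = false ∧ S ω = Sample.e}])))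
    -- β̃ := g(1) − g(0)
    (βt : ℝ) (hβt : βt = g true - g false)
    -- β := E[R | Y = 1] − E[R | Y = 0]
    (β : ℝ)
    (hβ : β = (∫ ω, b2r (R ω) ∂(P[|{ω | Y ω = true}])) -
      (∫ ω, b2r (R ω) ∂(P[|{ω | Y ω = false}])))
    -- θ := E[Y(1) − Y(0) | S = e]
    (θ : ℝ)
    (hθ : θ = ∫ ω, (b2r (Y1 ω) - b2r (Y0 ω)) ∂(P[|{ω | S ω = Sample.e}])) :
    θt = βt * β * θ := by
  have hSe : MeasurableSet {ω | S ω = Sample.e} := hS (MeasurableSet.of_discrete (s := {Sample.e}))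
  have hDm : ∀ d, MeasurableSet {ω | D ω = d} := fun d => hD (measurableSet_singleton d)
  have hDS : ∀ d, MeasurableSet {ω | D ω = d ∧ S ω = Sample.e} := fun d => (hDm d).inter hSe
  have hY : Measurable Y := by
    rw [funext hYdef]
    exact Measurable.ite (hDm true) hY1 hY0
  have hPDSY : ∀ d y, P ({ω | D ω = d ∧ S ω = Sample.e} ∩ {ω | Y ω = y}) ≠ 0 := by
    intro d y
    refine ne_of_gt (lt_of_lt_of_le (positivity_e d y) (measure_mono ?_))
    rintro ω ⟨h1, h2, h3⟩
    exact ⟨⟨h2, h1⟩, h3⟩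
  have hPDS : ∀ d, P {ω | D ω = d ∧ S ω = Sample.e} ≠ 0 := fun d h =>
    hPDSY d true (measure_mono_null Set.inter_subset_left h)
  have hPS : P {ω | S ω = Sample.e} ≠ 0 := fun h =>
    hPDS true (measure_mono_null (fun ω hω => hω.2) h)
  have : ∀ d, IsProbabilityMeasure (P[|{ω | D ω = d ∧ S ω = Sample.e}]) :=
    fun d => cond_isProbabilityMeasure (hPDS d)
  have : IsProbabilityMeasure (P[|{ω | S ω = Sample.e}]) := cond_isProbabilityMeasure hPS
  have : ∀ y, IsProbabilityMeasure (P[|{ω | Y ω = y}]) :=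
    fun y => cond_isProbabilityMeasure (positivity_Y y).ne'
  have hlaw : ∀ d y, (P[|{ω | D ω = d ∧ S ω = Sample.e} ∩ {ω | Y ω = y}]).real {ω | R ω = true} =
      (P[|{ω | Y ω = y}]).real {ω | R ω = true} := by
    intro d y
    have hset : {ω | (D ω, Y ω) = (d, y) ∧ S ω = Sample.e} =
        {ω | D ω = d ∧ S ω = Sample.e} ∩ {ω | Y ω = y} := by
      ext ω
      simp only [Prod.mk.injEq, Set.mem_ofPred_eq, Set.mem_inter_iff]
      tauto
    have hset' : {ω | (D ω, Y ω) = (d, y)} = {ω | Y ω = y ∧ D ω = d} := by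
      ext ω
      simp only [Prod.mk.injEq, Set.mem_ofPred_eq]
      tauto
    have h1 := stability (d, y) Sample.e (by
      rw [hset]
      exact pos_iff_ne_zero.mpr (hPDSY d y))
    have h2 := noDirectEffect y d (pos_iff_ne_zero.mpr fun h =>
      hPDSY d y (measure_mono_null (fun ω hω => And.intro hω.2 hω.1.1) h))
    rw [hset, hset', h2] at h1
    have h3 := congrArg (fun μ : Measure Bool => μ.real {true}) h1
    rwa [map_measureReal_apply hR (measurableSet_singleton true),
      map_measureReal_apply hR (measurableSet_singleton true)] at h3
  have hmix : ∀ d, (P[|{ω | D ω = d ∧ S ω = Sample.e}]).real {ω | R ω = true} =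
      (P[|{ω | Y ω = false}]).real {ω | R ω = true} +
      β * (P[|{ω | D ω = d ∧ S ω = Sample.e}]).real {ω | Y ω = true} := by
    intro d
    rw [hβ, integral_b2r _ hR, integral_b2r _ hR]
    exact cond_real_eq_mixture P hY (hDS d) (hPDS d) (hPDSY d) (hlaw d)
  have hrand : ∀ (d : Bool) (t : Set (Bool × Bool)),
      (∀ ω, D ω = d → ((Y0 ω, Y1 ω) ∈ t ↔ Y ω = true)) →
      (P[|{ω | D ω = d ∧ S ω = Sample.e}]).real {ω | Y ω = true} =
        (P[|{ω | S ω = Sample.e}]).real ((fun ω => (Y0 ω, Y1 ω)) ⁻¹' t) := by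
    intro d t ht
    have hinter : {ω | S ω = Sample.e} ∩ D ⁻¹' {d} = {ω | D ω = d ∧ S ω = Sample.e} := by
      ext ω
      exact and_comm
    have h0 : P[|{ω | S ω = Sample.e}] (D ⁻¹' {d}) ≠ 0 := by
      refine (cond_pos_of_inter_ne_zero hSe ?_).ne'
      rw [hinter]
      exact hPDS d
    rw [← cond_cond_real_of_indepFun _ randomization hD (measurableSet_singleton d)
      (MeasurableSet.of_discrete (s := t)) h0,
      cond_cond_eq_cond_inter hSe (hD (measurableSet_singleton d)), hinter, cond_real_eq_inv_mul _ (hDS d),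
      cond_real_eq_inv_mul _ (hDS d)]
    congr 2
    ext ω
    exact and_congr_right fun hω => (ht ω hω.1).symm
  have hr1 := hrand true {p | p.2 = true} (fun ω hω => by simp [hYdef, hω])
  have hr0 := hrand false {p | p.1 = true} (fun ω hω => by simp [hYdef, hω])
  rw [hθt, integral_comp_bool _ hR, integral_comp_bool _ hR, hmix, hmix, hr1, hr0, hβt, hθ,
    integral_sub (integrable_b2r _ hY1) (integrable_b2r _ hY0), integral_b2r _ hY1,
    integral_b2r _ hY0]
  simp only [Set.preimage_ofPred_eq]
  ring
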